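/- Let (X_i)_{i≥1} be i.i.d. exponential random variables with mean 1, fix θ > 0, set c = 1 + θ, and for initial capital u > −c define the risk process U_n = u + c n − (X_1 + ... + X_n) and the ruin probability ψ(u) := P(U_n < 0 for some n ∈ ℕ⁺). For x ≥ 1, let t(x) denote the unique t ∈ (0, 1] with t e^{−t} = x e^{−x}. Then: (a) ψ(u) = (t(c)/c) · exp( −u (1 − t(c)/c) ) for u > −c, and ψ(u) = 1 for u ≤ −c; (b) for every α ∈ (0, 1), there is a unique u > −(1+θ) with ψ(u) = α, and it is the unique root of the equation (1 + θ + u)(1 − α^{(1+θ)/(1+θ+u)}) = −log α on (−(1+θ), ∞). -/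

import Mathlib

open MeasureTheory ProbabilityTheory Real

namespace RuinExp

/-- One step of the killed process (capital after premium; `-1` means ruined). -/
noncomputable def step (c k x : ℝ) : ℝ :=
  if k < 0 then k else if k < x then -1 else k - x + c

/-- The killed process. -/
noncomputable def proc (c v : ℝ) (x : ℕ → ℝ) : ℕ → ℝ
  | 0 => v
  | n + 1 => step c (proc c v x n) (x n)

/-- Test functions. -/
noncomputable def H (a s k : ℝ) : ℝ := if k < 0 then a else Real.exp (-(s * k))

lemma measurable_step (c : ℝ) : Measurable (fun p : ℝ × ℝ => step c p.1 p.2) := by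
  unfold step
  refine Measurable.ite (measurableSet_lt measurable_fst measurable_const) measurable_fst ?_
  refine Measurable.ite (measurableSet_lt measurable_fst measurable_snd) measurable_const ?_
  fun_prop

lemma measurable_H (a s : ℝ) : Measurable (H a s) := by
  unfold H
  refine Measurable.ite (measurableSet_lt measurable_id measurable_const) measurable_const ?_
  fun_prop

lemma H_nonneg {a : ℝ} (s : ℝ) (ha : 0 ≤ a) (k : ℝ) : 0 ≤ H a s k := by
  unfold H; split_ifs
  · exact ha
  · positivity

lemma H_le_one {a s : ℝ} (ha : a ≤ 1) (hs : 0 ≤ s) (k : ℝ) : H a s k ≤ 1 := by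
  unfold H; split_ifs with h
  · exact ha
  · rw [Real.exp_le_one_iff]
    have := mul_nonneg hs (not_lt.1 h)
    linarith

lemma integral_expMeasure (g : ℝ → ℝ) :
    ∫ x, g x ∂(expMeasure 1) = ∫ x in Set.Ioi 0, Real.exp (-x) * g x := by
  have h1 : expMeasure 1 = volume.withDensity (exponentialPDF 1) := rfl
  rw [h1, integral_withDensity_eq_integral_toReal_smul
    (show Measurable (exponentialPDF 1) from (measurable_exponentialPDFReal 1).ennreal_ofReal)
    (Filter.Eventually.of_forall fun x => ENNReal.ofReal_lt_top),
    ← integral_Ici_eq_integral_Ioi, ← integral_indicator measurableSet_Ici]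
  congr 1
  ext x
  rw [exponentialPDF_eq]
  by_cases hx : 0 ≤ x
  · simp [hx, Set.indicator, Real.exp_nonneg]
  · simp [hx, Set.indicator]

lemma integral_H_step {a s c k : ℝ} (hs : s < 1) (hc : 0 ≤ c) (hk : 0 ≤ k) :
    ∫ x, H a s (step c k x) ∂(expMeasure 1) =
      a * Real.exp (-k) +
        Real.exp (-(s * (k + c))) * (1 - Real.exp (-((1 - s) * k))) / (1 - s) := by
  have hs' : 0 < 1 - s := by linarith
  have hH : ∀ x, H a s (step c k x) =
      if k < x then a else Real.exp (-(s * (k - x + c))) := by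
    intro x
    unfold H step
    rw [if_neg (not_lt.2 hk)]
    split_ifs with h1 h2 h3
    · rfl
    · norm_num at h2
    · linarith
    · rfl
  rw [integral_expMeasure]
  have e1 : Set.EqOn (fun x => Real.exp (-x) * H a s (step c k x))
      (fun x => Real.exp (-(s * (k + c))) * Real.exp (-((1 - s) * x))) (Set.Ioc 0 k) := by
    intro x hx
    simp only [hH, if_neg (not_lt.2 hx.2), ← Real.exp_add]
    congr 1; ring
  have e2 : Set.EqOn (fun x => Real.exp (-x) * H a s (step c k x))
      (fun x => Real.exp (-x) * a) (Set.Ioi k) := by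
    intro x hx
    simp only [hH, if_pos (Set.mem_Ioi.1 hx)]
  have i1 : IntegrableOn
      (fun x => Real.exp (-(s * (k + c))) * Real.exp (-((1 - s) * x))) (Set.Ioc 0 k) :=
    (exp_neg_integrableOn_Ioc hs').const_mul _
  have i2 : IntegrableOn (fun x => Real.exp (-x) * a) (Set.Ioi k) :=
    (integrableOn_exp_neg_Ioi k).mul_const a
  rw [← Set.Ioc_union_Ioi_eq_Ioi hk, setIntegral_union (Set.Ioc_disjoint_Ioi le_rfl)
    measurableSet_Ioi (i1.congr_fun e1.symm measurableSet_Ioc)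
    (i2.congr_fun e2.symm measurableSet_Ioi),
    setIntegral_congr_fun measurableSet_Ioc e1, setIntegral_congr_fun measurableSet_Ioi e2,
    integral_mul_const, integral_exp_neg_Ioi, integral_const_mul,
    ← intervalIntegral.integral_of_le hk]
  have : ∫ x in (0:ℝ)..k, Real.exp (-((1 - s) * x)) =
      (1 - Real.exp (-((1 - s) * k))) / (1 - s) := by
    have hd : ∀ x ∈ Set.uIcc 0 k, HasDerivAt (fun x => -Real.exp (-((1 - s) * x)) / (1 - s))
        (Real.exp (-((1 - s) * x))) x := by
      intro x _
      have := (hasDerivAt_neg_exp_mul_exp (r := 1 - s) (x := x)).div_const (1 - s)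
      convert! this using 1
      field_simp
    rw [intervalIntegral.integral_eq_sub_of_hasDerivAt hd
      (Continuous.intervalIntegrable (by fun_prop) _ _)]
    simp
    ring
  rw [this]
  ring

lemma proc_factor (c v : ℝ) (n : ℕ) : ∃ φ : (Finset.range n → ℝ) → ℝ, Measurable φ ∧
    ∀ x : ℕ → ℝ, proc c v x n = φ (fun i => x i) := by
  induction n with
  | zero => exact ⟨fun _ => v, measurable_const, fun x => rfl⟩
  | succ n ih =>
    obtain ⟨φ, hφ, h⟩ := ih
    refine ⟨fun y => step c (φ fun i => y ⟨i, by
      have := Finset.mem_range.1 i.2; exact Finset.mem_range.2 (by omega)⟩)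
      (y ⟨n, Finset.self_mem_range_succ n⟩), ?_, ?_⟩
    · refine (measurable_step c).comp (Measurable.prodMk (hφ.comp ?_) (measurable_pi_apply _))
      exact measurable_pi_lambda _ fun i => measurable_pi_apply _
    · intro x
      simp only [proc, h]

section
variable {Ω : Type*} [MeasurableSpace Ω] {μ : Measure Ω} [IsProbabilityMeasure μ]
  {X : ℕ → Ω → ℝ}

lemma measurable_proc (hmeas : ∀ i, Measurable (X i)) (c v : ℝ) (n : ℕ) :
    Measurable (fun ω => proc c v (fun i => X i ω) n) := by
  obtain ⟨φ, hφ, h⟩ := proc_factor c v n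
  simp only [h]
  exact hφ.comp (measurable_pi_lambda _ fun i => hmeas _)

lemma indep_proc (hmeas : ∀ i, Measurable (X i)) (hindep : iIndepFun X μ) (c v : ℝ) (n : ℕ) :
    IndepFun (fun ω => proc c v (fun i => X i ω) n) (X n) μ := by
  obtain ⟨φ, hφ, h⟩ := proc_factor c v n
  simp only [h]
  have h1 := hindep.indepFun_finset (Finset.range n) {n} (by simp) hmeas
  have hm : Measurable (fun y : ({n} : Finset ℕ) → ℝ => y ⟨n, Finset.mem_singleton_self n⟩) :=
    measurable_pi_apply _
  exact h1.comp hφ hm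

lemma integral_H_succ (hmeas : ∀ i, Measurable (X i)) (hindep : iIndepFun X μ)
    (hdist : ∀ i, Measure.map (X i) μ = expMeasure 1) (c v : ℝ) (n : ℕ) {a s : ℝ}
    (ha0 : 0 ≤ a) (ha : a ≤ 1) (hs : 0 ≤ s) :
    ∫ ω, H a s (proc c v (fun i => X i ω) (n + 1)) ∂μ =
      ∫ ω, (∫ x, H a s (step c (proc c v (fun i => X i ω) n) x) ∂(expMeasure 1)) ∂μ := by
  have hK := measurable_proc hmeas c v n
  have := isProbabilityMeasure_expMeasure (r := 1) one_pos
  have hp := (indep_proc hmeas hindep c v n).map_prod_eq_prod_map_map hK.aemeasurable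
    (hmeas n).aemeasurable
  rw [hdist] at hp
  have hm : Measurable (fun p : ℝ × ℝ => H a s (step c p.1 p.2)) :=
    (measurable_H a s).comp (measurable_step c)
  have : IsProbabilityMeasure (Measure.map (fun ω => proc c v (fun i => X i ω) n) μ) :=
    Measure.isProbabilityMeasure_map hK.aemeasurable
  have hi : Integrable (fun p : ℝ × ℝ => H a s (step c p.1 p.2))
      ((Measure.map (fun ω => proc c v (fun i => X i ω) n) μ).prod (expMeasure 1)) := by
    refine Integrable.of_bound hm.aestronglyMeasurable 1 (Filter.Eventually.of_forall fun p => ?_)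
    rw [Real.norm_of_nonneg (H_nonneg s ha0 _)]
    exact H_le_one ha hs _
  calc ∫ ω, H a s (proc c v (fun i => X i ω) (n + 1)) ∂μ
      = ∫ p, H a s (step c p.1 p.2)
          ∂(Measure.map (fun ω => (proc c v (fun i => X i ω) n, X n ω)) μ) := by
        rw [integral_map (hK.prodMk (hmeas n)).aemeasurable hm.aestronglyMeasurable]
        rfl
    _ = _ := by
        rw [hp, integral_prod _ hi, integral_map hK.aemeasurable]
        exact hi.integral_prod_left.aestronglyMeasurable

lemma integrable_H (hmeas : ∀ i, Measurable (X i)) (c v : ℝ) (n : ℕ) {a s : ℝ}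
    (ha0 : 0 ≤ a) (ha : a ≤ 1) (hs : 0 ≤ s) :
    Integrable (fun ω => H a s (proc c v (fun i => X i ω) n)) μ := by
  refine Integrable.of_bound
    ((measurable_H a s).comp (measurable_proc hmeas c v n)).aestronglyMeasurable 1
    (Filter.Eventually.of_forall fun p => ?_)
  rw [Real.norm_of_nonneg (H_nonneg s ha0 _)]
  exact H_le_one ha hs _

lemma integral_H_martingale (hmeas : ∀ i, Measurable (X i)) (hindep : iIndepFun X μ)
    (hdist : ∀ i, Measure.map (X i) μ = expMeasure 1) {c v R : ℝ} (hc : 0 ≤ c) (hv : 0 ≤ v)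
    (hR0 : 0 ≤ R) (hR1 : R < 1) (hR : Real.exp (-(R * c)) = 1 - R) (n : ℕ) :
    ∫ ω, H 1 R (proc c v (fun i => X i ω) n) ∂μ = Real.exp (-(R * v)) := by
  have := isProbabilityMeasure_expMeasure (r := 1) one_pos
  induction n with
  | zero => simp [proc, H, not_lt.2 hv]
  | succ n ih =>
    rw [integral_H_succ hmeas hindep hdist c v n zero_le_one le_rfl hR0, ← ih]
    congr 1
    ext ω
    generalize proc c v (fun i => X i ω) n = k
    by_cases hk : k < 0
    · simp [H, step, hk]
    · rw [integral_H_step hR1 hc (not_lt.1 hk)]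
      have hR1' : 1 - R ≠ 0 := by linarith
      have e : Real.exp (-(R * (k + c))) = Real.exp (-(R * k)) * (1 - R) := by
        rw [← hR, ← Real.exp_add]; congr 1; ring
      have e2 : Real.exp (-k) = Real.exp (-(R * k)) * Real.exp (-((1 - R) * k)) := by
        rw [← Real.exp_add]; congr 1; ring
      simp only [H, if_neg hk]
      rw [e, e2]
      field_simp
      ring

lemma integral_H_decay (hmeas : ∀ i, Measurable (X i)) (hindep : iIndepFun X μ)
    (hdist : ∀ i, Measure.map (X i) μ = expMeasure 1) {c v s : ℝ} (hc : 0 ≤ c) (hv : 0 ≤ v)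
    (hs0 : 0 ≤ s) (hs1 : s < 1) (n : ℕ) :
    ∫ ω, H 0 s (proc c v (fun i => X i ω) n) ∂μ ≤ (Real.exp (-(s * c)) / (1 - s)) ^ n := by
  have := isProbabilityMeasure_expMeasure (r := 1) one_pos
  have hs' : 0 < 1 - s := by linarith
  induction n with
  | zero =>
    simp only [proc, H, not_lt.2 hv]
    simpa using mul_nonneg hs0 hv
  | succ n ih =>
    rw [integral_H_succ hmeas hindep hdist c v n le_rfl zero_le_one hs0, pow_succ']
    refine le_trans ?_ (mul_le_mul_of_nonneg_left ih (by positivity))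
    rw [← integral_const_mul]
    refine integral_mono_of_nonneg (Filter.Eventually.of_forall fun ω =>
      integral_nonneg fun x => H_nonneg s le_rfl _)
      ((integrable_H hmeas c v n le_rfl zero_le_one hs0).const_mul _)
      (Filter.Eventually.of_forall fun ω => ?_)
    dsimp only
    generalize proc c v (fun i => X i ω) n = k
    by_cases hk : k < 0
    · simp [H, step, hk]
    · rw [integral_H_step hs1 hc (not_lt.1 hk)]
      have e : Real.exp (-(s * (k + c))) = Real.exp (-(s * c)) * Real.exp (-(s * k)) := by
        rw [← Real.exp_add]; congr 1; ring
      simp only [H, if_neg hk]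
      rw [e, zero_mul, zero_add, div_mul_eq_mul_div]
      apply div_le_div_of_nonneg_right _ hs'.le
      have : 0 ≤ Real.exp (-((1 - s) * k)) := Real.exp_nonneg _
      have h2 : 0 ≤ Real.exp (-(s * c)) * Real.exp (-(s * k)) := by positivity
      nlinarith

lemma proc_spec (c u : ℝ) (hc : 0 ≤ c) (hu : 0 ≤ u + c) (x : ℕ → ℝ) (n : ℕ) :
    (proc c (u + c) x n < 0 ∧
      ∃ m : ℕ, 1 ≤ m ∧ m ≤ n ∧ u + c * m - ∑ j ∈ Finset.range m, x j < 0) ∨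
    (proc c (u + c) x n = u + c * n - ∑ j ∈ Finset.range n, x j + c ∧
      0 ≤ proc c (u + c) x n ∧
      ∀ m : ℕ, 1 ≤ m → m ≤ n → 0 ≤ u + c * m - ∑ j ∈ Finset.range m, x j) := by
  induction n with
  | zero =>
    right
    refine ⟨by simp [proc], by simpa [proc] using hu, fun m h1 h2 => by omega⟩
  | succ n ih =>
    rcases ih with ⟨h, m, h1, h2, h3⟩ | ⟨h, h0, h1⟩
    · left
      refine ⟨?_, m, h1, by omega, h3⟩
      simpa [proc, step, h] using h
    · have hS := Finset.sum_range_succ x n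
      by_cases hx : proc c (u + c) x n < x n
      · left
        refine ⟨by simp [proc, step, not_lt.2 h0, hx], n + 1, by omega, le_rfl, ?_⟩
        push_cast
        linarith
      · right
        have e : proc c (u + c) x (n + 1) = proc c (u + c) x n - x n + c := by
          simp [proc, step, not_lt.2 h0, hx]
        refine ⟨?_, ?_, ?_⟩
        · rw [e, h]; push_cast; linarith
        · rw [e]; linarith
        · intro m hm1 hm2
          rcases Nat.lt_or_ge n m with h5 | h5
          · obtain rfl : m = n + 1 := by omega
            push_cast
            linarith
          · exact h1 m hm1 h5

lemma ruin_prob (hmeas : ∀ i, Measurable (X i)) (hindep : iIndepFun X μ)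
    (hdist : ∀ i, Measure.map (X i) μ = expMeasure 1) {c u R : ℝ} (hc : 0 ≤ c) (hu : 0 ≤ u + c)
    (hR0 : 0 < R) (hR1 : R < 1) (hR : Real.exp (-(R * c)) = 1 - R) :
    (μ {ω | ∃ n : ℕ, 1 ≤ n ∧ u + c * n - ∑ j ∈ Finset.range n, X j ω < 0}).toReal =
      Real.exp (-(R * (u + c))) := by
  set A : ℕ → Set Ω := fun n => {ω | proc c (u + c) (fun i => X i ω) n < 0} with hA
  have hAm : ∀ n, MeasurableSet (A n) := fun n =>
    measurableSet_lt (measurable_proc hmeas c (u + c) n) measurable_const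
  have hmono : Monotone A := by
    refine monotone_nat_of_le_succ fun n ω hω => ?_
    simp only [hA, Set.mem_setOf_eq] at hω ⊢
    simpa [proc, step, hω] using hω
  have hU : {ω | ∃ n : ℕ, 1 ≤ n ∧ u + c * n - ∑ j ∈ Finset.range n, X j ω < 0} = ⋃ n, A n := by
    ext ω
    simp only [hA, Set.mem_setOf_eq, Set.mem_iUnion]
    constructor
    · rintro ⟨n, h1, h2⟩
      refine ⟨n, ?_⟩
      rcases proc_spec c u hc hu (fun i => X i ω) n with h | h
      · exact h.1
      · exact absurd h2 (not_lt.2 (h.2.2 n h1 le_rfl))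
    · rintro ⟨n, hn⟩
      rcases proc_spec c u hc hu (fun i => X i ω) n with ⟨_, m, h1, _, h2⟩ | h
      · exact ⟨m, h1, h2⟩
      · exact absurd hn (not_lt.2 h.2.1)
  rw [hU]
  have t1 : Filter.Tendsto (fun n => (μ (A n)).toReal) Filter.atTop
      (nhds (μ (⋃ n, A n)).toReal) :=
    (ENNReal.tendsto_toReal (measure_ne_top _ _)).comp (tendsto_measure_iUnion_atTop hmono)
  refine tendsto_nhds_unique t1 ?_
  -- decomposition
  have hdec : ∀ n, (μ (A n)).toReal = Real.exp (-(R * (u + c))) -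
      ∫ ω, H 0 R (proc c (u + c) (fun i => X i ω) n) ∂μ := by
    intro n
    have h1 := integral_H_martingale hmeas hindep hdist hc hu hR0.le hR1 hR n
    have h2 : ∀ ω, H 1 R (proc c (u + c) (fun i => X i ω) n) =
        (A n).indicator 1 ω + H 0 R (proc c (u + c) (fun i => X i ω) n) := by
      intro ω
      by_cases h : proc c (u + c) (fun i => X i ω) n < 0
      · simp [H, Set.indicator, hA, h]
      · simp [H, Set.indicator, hA, h]
    simp only [h2] at h1
    rw [integral_add (show Integrable (fun ω => (A n).indicator (1 : Ω → ℝ) ω) μ from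
      (integrable_const (1 : ℝ)).indicator (hAm n))
      (integrable_H hmeas c (u + c) n le_rfl zero_le_one hR0.le),
      integral_indicator_one (hAm n)] at h1
    rw [Measure.real] at h1
    linarith
  simp only [hdec]
  have hlim : Filter.Tendsto (fun n => ∫ ω, H 0 R (proc c (u + c) (fun i => X i ω) n) ∂μ)
      Filter.atTop (nhds 0) := by
    set s := R / 2 with hs
    have hρ : Real.exp (-(s * c)) / (1 - s) < 1 := by
      rw [div_lt_one (by linarith)]
      have hy : Real.exp (-(s * c)) * Real.exp (-(s * c)) = 1 - R := by
        rw [← hR, ← Real.exp_add]; congr 1; rw [hs]; ring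
      have hne : Real.exp (-(s * c)) ≠ 1 := by
        intro h; rw [h] at hy; linarith
      have := sq_pos_of_ne_zero (sub_ne_zero.2 hne)
      nlinarith
    have hρ0 : 0 ≤ Real.exp (-(s * c)) / (1 - s) :=
      div_nonneg (Real.exp_nonneg _) (by linarith)
    refine squeeze_zero (fun n => integral_nonneg fun ω => H_nonneg R le_rfl _) (fun n => ?_)
      (tendsto_pow_atTop_nhds_zero_of_lt_one hρ0 hρ)
    refine le_trans ?_ (integral_H_decay hmeas hindep hdist hc hu (s := s) (by linarith)
      (by linarith) n)
    refine integral_mono (integrable_H hmeas c (u + c) n le_rfl zero_le_one hR0.le)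
      (integrable_H hmeas c (u + c) n le_rfl zero_le_one (by linarith)) fun ω => ?_
    dsimp only
    unfold H
    split_ifs with h
    · exact le_rfl
    · apply Real.exp_le_exp.2
      have := not_lt.1 h
      nlinarith
  simpa using hlim.const_sub (Real.exp (-(R * (u + c))))

lemma ruin_one (hmeas : ∀ i, Measurable (X i))
    (hdist : ∀ i, Measure.map (X i) μ = expMeasure 1) {c u : ℝ} (hu : u ≤ -c) :
    (μ {ω | ∃ n : ℕ, 1 ≤ n ∧ u + c * n - ∑ j ∈ Finset.range n, X j ω < 0}).toReal = 1 := by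
  have := isProbabilityMeasure_expMeasure (r := 1) one_pos
  have h0 : μ {ω | ¬ 0 < X 0 ω} = 0 := by
    have h1 : {ω | ¬ 0 < X 0 ω} = X 0 ⁻¹' Set.Iic 0 := by ext ω; simp
    rw [h1, ← Measure.map_apply (hmeas 0) measurableSet_Iic, hdist]
    have h2 := cdf_expMeasure_eq (r := 1) one_pos 0
    rw [cdf_eq_real] at h2
    simpa [Measure.real, ENNReal.toReal_eq_zero_iff] using h2
  have h1 : ∀ᵐ ω ∂μ, ω ∈ {ω | ∃ n : ℕ, 1 ≤ n ∧ u + c * n - ∑ j ∈ Finset.range n, X j ω < 0} := by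
    have : ∀ᵐ ω ∂μ, 0 < X 0 ω := h0
    filter_upwards [this] with ω hω
    refine ⟨1, le_rfl, ?_⟩
    simp
    linarith
  rw [measure_eq_measure_of_null_diff (Set.subset_univ _) (by
    rw [← Set.compl_eq_univ_diff]; exact h1)]
  simp

end

lemma mul_exp_neg_lt {x y : ℝ} (hx : 1 ≤ x) (hxy : x < y) :
    y * Real.exp (-y) < x * Real.exp (-x) := by
  have h1 : y - x + 1 < Real.exp (y - x) := Real.add_one_lt_exp (by linarith)
  have h2 : Real.exp (-x) = Real.exp (y - x) * Real.exp (-y) := by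
    rw [← Real.exp_add]; congr 1; ring
  rw [h2, ← mul_assoc]
  apply mul_lt_mul_of_pos_right _ (Real.exp_pos _)
  nlinarith

lemma mul_exp_neg_lt' {x y : ℝ} (hx : y ≤ 1) (hxy : x < y) :
    x * Real.exp (-x) < y * Real.exp (-y) := by
  have h1 : x - y + 1 < Real.exp (x - y) := Real.add_one_lt_exp (by linarith)
  have h2 : Real.exp (-y) = Real.exp (x - y) * Real.exp (-x) := by
    rw [← Real.exp_add]; congr 1; ring
  rw [h2, ← mul_assoc]
  apply mul_lt_mul_of_pos_right _ (Real.exp_pos _)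
  by_cases hy : 0 < y
  · nlinarith
  · have : Real.exp (x - y) < 1 := by rw [Real.exp_lt_one_iff]; linarith
    nlinarith

end RuinExp

/-- Risk model with i.i.d. exponential claims of mean 1, premium rate `c = 1 + θ`
(`θ > 0`), risk process `U_n = u + c n - (X_1 + ⋯ + X_n)` and ruin probability
`ψ(u) = P(U_n < 0 for some n ≥ 1)`.  Let `t(c)` be the unique `t ∈ (0, 1]` with
`t e^{-t} = c e^{-c}`.  Then:
(a) `ψ(u) = (t(c)/c)·exp(-u(1 - t(c)/c))` for `u > -c`, and `ψ(u) = 1` for `u ≤ -c`;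
(b) for every `α ∈ (0, 1)` there is a unique `u > -(1+θ)` with `ψ(u) = α`, and it is
the unique root of `(1+θ+u)(1 - α^{(1+θ)/(1+θ+u)}) = -log α` on `(-(1+θ), ∞)`. -/
theorem ruinProbability_exponential
    {Ω : Type*} [MeasureSpace Ω] [IsProbabilityMeasure (ℙ : Measure Ω)]
    (X : ℕ → Ω → ℝ) (hmeas : ∀ i, Measurable (X i))
    (hindep : iIndepFun X ℙ)
    (hdist : ∀ i, Measure.map (X i) ℙ = expMeasure 1)
    (θ : ℝ) (hθ : 0 < θ) (c : ℝ) (hc : c = 1 + θ)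
    (tc : ℝ) (htc : tc ∈ Set.Ioc (0 : ℝ) 1)
    (htcc : tc * Real.exp (-tc) = c * Real.exp (-c))
    (ψ : ℝ → ℝ)
    (hψ : ∀ u : ℝ, ψ u =
      (ℙ {ω | ∃ n : ℕ, 1 ≤ n ∧ u + c * n - ∑ j ∈ Finset.range n, X j ω < 0}).toReal) :
    ((∀ u : ℝ, -c < u → ψ u = tc / c * Real.exp (-u * (1 - tc / c))) ∧
      (∀ u : ℝ, u ≤ -c → ψ u = 1)) ∧
    (∀ α ∈ Set.Ioo (0 : ℝ) 1,
      (∃! u : ℝ, -(1 + θ) < u ∧ ψ u = α) ∧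
      (∀ u : ℝ, -(1 + θ) < u →
        (ψ u = α ↔
          (1 + θ + u) * (1 - α ^ ((1 + θ) / (1 + θ + u))) = -Real.log α))) := by
  have hc1 : 1 < c := by linarith
  have hc0 : 0 < c := by linarith
  obtain ⟨ht0, ht1⟩ := htc
  obtain ⟨q, hq⟩ : ∃ q, q = tc / c := ⟨_, rfl⟩
  have hqc : tc = q * c := by rw [hq]; field_simp
  have hq0 : 0 < q := by rw [hq]; positivity
  have hq1 : q < 1 := by rw [hq, div_lt_one hc0]; linarith
  have hqe : Real.exp (-((1 - q) * c)) = q := by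
    have h1 : Real.exp (-((1 - q) * c)) = Real.exp (-c) * Real.exp tc := by
      rw [← Real.exp_add, hqc]; congr 1; ring
    have h2 : Real.exp (-tc) * Real.exp tc = 1 := by rw [← Real.exp_add]; simp
    rw [h1, hq, eq_div_iff hc0.ne']
    calc Real.exp (-c) * Real.exp tc * c = (c * Real.exp (-c)) * Real.exp tc := by ring
      _ = tc * (Real.exp (-tc) * Real.exp tc) := by rw [← htcc]; ring
      _ = tc := by rw [h2, mul_one]
  have hmain : ∀ u : ℝ, -c < u → ψ u = Real.exp (-((1 - q) * (u + c))) := fun u hu => by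
    rw [hψ]
    exact RuinExp.ruin_prob hmeas hindep hdist hc0.le (by linarith) (by linarith) (by linarith)
      (by rw [hqe]; ring)
  rw [← hc]
  have hpsi : ∀ α ∈ Set.Ioo (0 : ℝ) 1, ∀ u : ℝ, -c < u →
      (ψ u = α ↔ (u + c) * (1 - q) = -Real.log α) := by
    intro α hα u hu
    rw [hmain u hu]
    constructor
    · intro h
      rw [← h, Real.log_exp]; ring
    · intro h
      have : -((1 - q) * (u + c)) = Real.log α := by linarith
      rw [this, Real.exp_log hα.1]
  refine ⟨⟨fun u hu => ?_, fun u hu => ?_⟩, fun α hα => ⟨?_, fun u hu => ?_⟩⟩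
  · rw [hmain u hu, ← hq]
    have e : Real.exp (-((1 - q) * (u + c))) =
        Real.exp (-((1 - q) * c)) * Real.exp (-u * (1 - q)) := by
      rw [← Real.exp_add]; congr 1; ring
    rw [e, hqe]
  · rw [hψ]
    exact RuinExp.ruin_one hmeas hdist hu
  · have hl := Real.log_neg hα.1 hα.2
    have hq1' : 0 < 1 - q := by linarith
    have hpos : 0 < -Real.log α / (1 - q) := div_pos (by linarith) hq1'
    refine ⟨-Real.log α / (1 - q) - c, ⟨by linarith, ?_⟩, ?_⟩
    · rw [hpsi α hα _ (by linarith)]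
      field_simp
      ring
    · rintro u ⟨hu, h⟩
      rw [hpsi α hα u hu, ← eq_div_iff hq1'.ne'] at h
      linarith
  · rw [hpsi α hα u hu]
    have hv : 0 < c + u := by linarith
    set p := α ^ (c / (c + u)) with hp
    have hp0 : 0 < p := Real.rpow_pos_of_pos hα.1 _
    have hp1 : p < 1 := Real.rpow_lt_one hα.1.le hα.2 (by positivity)
    have hlp : Real.log p = c / (c + u) * Real.log α := by rw [hp, Real.log_rpow hα.1]
    have hla : Real.log α = (c + u) / c * Real.log p := by rw [hlp]; field_simp
    constructor
    · intro h
      have hpq : p = q := by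
        rw [← Real.exp_log hp0, hlp]
        conv_rhs => rw [← hqe]
        congr 1
        have : Real.log α = -((u + c) * (1 - q)) := by linarith
        rw [this]; field_simp; ring
      rw [hpq]; linarith
    · intro h
      have h1 : -(c * (1 - p)) = Real.log p := by
        rw [hla] at h
        field_simp at h
        linarith
      have h2 : p * c * Real.exp (-(p * c)) = c * Real.exp (-c) := by
        have : p = Real.exp (-(c * (1 - p))) := by rw [h1, Real.exp_log hp0]
        have e : Real.exp (-c) = Real.exp (-(c * (1 - p))) * Real.exp (-(p * c)) := by
          rw [← Real.exp_add]; congr 1; ring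
        rw [e, ← this]; ring
      have h3 : p * c ≤ 1 := by
        by_contra h4
        have := RuinExp.mul_exp_neg_lt (not_le.1 h4).le (show p * c < c by nlinarith)
        linarith
      have h5 : p * c = tc := by
        rcases lt_trichotomy (p * c) tc with h6 | h6 | h6
        · have := RuinExp.mul_exp_neg_lt' ht1 h6
          linarith
        · exact h6
        · have := RuinExp.mul_exp_neg_lt' h3 h6
          linarith
      have hpq : p = q := by rw [hq, ← h5]; field_simp
      rw [← hpq, ← h]; ring
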